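/- Let g : ℝⁿ × ℝ → ℝᵐ be continuously differentiable, let F(t) = {y ∈ ℝⁿ : g(y,t) ≤ 0 componentwise}, and suppose x ∈ F(t̂). Let v ∈ ℝⁿ be such that for every component k with g_k(x, t̂) = 0 one has the strict inequality ∇_x g_k(x,t̂)ᵀ v + ∂_t g_k(x,t̂) < 0. Then v belongs to the temporal contingent cone T_F^{t̂}(x); in fact d(x+hv, F(t̂+h)) = 0 for all sufficiently small h > 0. (Reverse inclusion, under strict inequality, in the active-constraint case of the temporal contingent cone formula.) -/

import Mathlib

open Filter Metric Set Topology

/-- A real function with negative derivative at `a` lies below its value at `a` just to the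
right of `a`. -/
theorem HasDerivAt.eventually_lt_right_of_neg {f : ℝ → ℝ} {f' a : ℝ}
    (hf : HasDerivAt f f' a) (hf' : f' < 0) : ∀ᶠ y in 𝓝[>] a, f y < f a := by
  have hslope : Tendsto (slope f a) (𝓝[>] a) (𝓝 f') :=
    (hasDerivAt_iff_tendsto_slope.mp hf).mono_left
      (nhdsWithin_mono a fun y hy => ne_of_gt hy)
  filter_upwards [hslope.eventually_lt_const hf', self_mem_nhdsWithin] with y hy hay
  rw [slope_def_field, div_neg_iff] at hy
  have : a < y := hay
  rcases hy with h | h <;> linarith [h.1, h.2]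

/-- Moving from a feasible point along a direction that strictly decreases every active
constraint keeps all the constraints satisfied for a short time. -/
theorem eventually_forall_apply_add_smul_nonpos {E ι : Type*} [NormedAddCommGroup E]
    [NormedSpace ℝ E] [Fintype ι] {g : E → ι → ℝ} {p w : E} (hg : DifferentiableAt ℝ g p)
    (hp : ∀ k, g p k ≤ 0) (hw : ∀ k, g p k = 0 → fderiv ℝ g p w k < 0) :
    ∀ᶠ h in 𝓝[>] (0 : ℝ), ∀ k, g (p + h • w) k ≤ 0 := by
  have hderiv : HasDerivAt (fun h : ℝ => g (p + h • w)) (fderiv ℝ g p w) 0 :=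
    hg.hasFDerivAt.hasLineDerivAt w
  refine eventually_all.mpr fun k => ?_
  have hk : HasDerivAt (fun h : ℝ => g (p + h • w) k) (fderiv ℝ g p w k) 0 :=
    hasDerivAt_pi.mp hderiv k
  rcases (hp k).lt_or_eq with hlt | heq
  · have hlt' : g (p + (0 : ℝ) • w) k < 0 := by simpa using hlt
    filter_upwards [(hk.continuousAt.eventually_lt_const hlt').filter_mono
      nhdsWithin_le_nhds] with h hh using hh.le
  · filter_upwards [hk.eventually_lt_right_of_neg (hw k heq)] with h hh
    simpa [heq] using hh.le

/-- Reverse inclusion (under strict inequality) in the active-constraint case of the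
temporal contingent cone formula: if `g` is `C¹`, `x ∈ F(t̂)` with
`F(t) = {y | g(y,t) ≤ 0}`, and `v` satisfies the strict tangency inequality
`∇_x g_k(x,t̂)ᵀ v + ∂_t g_k(x,t̂) < 0` for every active component `k`, then
`d(x+hv, F(t̂+h)) = 0` for all sufficiently small `h > 0`, and in particular `v`
belongs to the temporal contingent cone `T_F^{t̂}(x)`. -/
theorem temporal_contingent_cone_active_reverse
    {n m : ℕ} (g : EuclideanSpace ℝ (Fin n) × ℝ → Fin m → ℝ)
    (hg : ContDiff ℝ 1 g)
    (F : ℝ → Set (EuclideanSpace ℝ (Fin n)))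
    (hF : ∀ t, F t = {y | ∀ k, g (y, t) k ≤ 0})
    (x : EuclideanSpace ℝ (Fin n)) (tHat : ℝ)
    (hx : ∀ k, g (x, tHat) k ≤ 0)
    (v : EuclideanSpace ℝ (Fin n))
    (hv : ∀ k, g (x, tHat) k = 0 → fderiv ℝ g (x, tHat) (v, 1) k < 0) :
    (∀ᶠ h in 𝓝[>] (0:ℝ), Metric.infDist (x + h • v) (F (tHat + h)) = 0) ∧
    Filter.liminf
      (fun h : ℝ => Metric.infDist (x + h • v) (F (tHat + h)) / h) (𝓝[>] 0) = 0 := by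
  have hdist : ∀ᶠ h in 𝓝[>] (0 : ℝ), Metric.infDist (x + h • v) (F (tHat + h)) = 0 := by
    filter_upwards [eventually_forall_apply_add_smul_nonpos
      (hg.differentiable one_ne_zero (x, tHat)) hx hv] with h hh
    refine Metric.infDist_zero_of_mem ?_
    rw [hF]
    simpa using hh
  refine ⟨hdist, Tendsto.liminf_eq (tendsto_const_nhds.congr' ?_)⟩
  filter_upwards [hdist] with h hh
  simp [hh]
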